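/- arXiv:1812.02022 — 2 statements merged into one kernel-verified Lean document; each statement's English description precedes it below -/
import Mathlib

section
/- Let d ≥ 1, ω ∈ (0,∞)^d, and let a: ℝ^{2d} → ℂ be bounded and continuous. Then for every z ∈ ℝ^{2d}, the time average (1/T)∫_0^T a(φ_t^H(z)) dt converges as T → ∞ to ⟨a⟩(z) = ∫_{G_ω} a(Φ_τ^H(z)) dν_ω(τ). -/
open MeasureTheory Real Filter Topology
open scoped ENNReal BigOperators

noncomputable section

/-- Phase space ℝ^{2d} = (x, ξ). -/
abbrev Pd (d : ℕ) : Type := (Fin d → ℝ) × (Fin d → ℝ)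

/-- Euclidean inner product on phase space. -/
def dotP {d : ℕ} (w z : Pd d) : ℝ :=
  (∑ j, w.1 j * z.1 j) + ∑ j, w.2 j * z.2 j

/-- Euclidean norm on phase space. -/
def normP {d : ℕ} (z : Pd d) : ℝ :=
  Real.sqrt ((∑ j, (z.1 j) ^ 2) + ∑ j, (z.2 j) ^ 2)

/-- Fourier transform  â(w) = ∫ e^{-i w·z} a(z) dz. -/
def fourierT {d : ℕ} (a : Pd d → ℂ) (w : Pd d) : ℂ :=
  ∫ z : Pd d, Complex.exp (-(Complex.I * (dotP w z))) * a z

/-- The analytic norm ‖a‖_s = ∫ |â(w)| e^{s‖w‖} dw  (with values in ℝ≥0∞). -/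
def Anorm {d : ℕ} (s : ℝ) (a : Pd d → ℂ) : ℝ≥0∞ :=
  ∫⁻ w : Pd d, ENNReal.ofReal (‖fourierT a w‖ * Real.exp (s * normP w))

/-- Membership in the space A_s : integrable with finite ‖·‖_s norm. -/
def MemAs {d : ℕ} (s : ℝ) (a : Pd d → ℂ) : Prop :=
  Integrable a ∧ Anorm s a < ⊤

instance fact2pi : Fact (0 < 2 * Real.pi) := ⟨Real.two_pi_pos⟩

/-- The circle ℝ/2πℤ. -/
abbrev Circle2pi : Type := AddCircle (2 * Real.pi)

/-- The torus 𝕋^d = ℝ^d/2πℤ^d. -/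
abbrev Torus (d : ℕ) : Type := Fin d → Circle2pi

/-- Cosine on the circle. -/
def aCos : Circle2pi → ℝ := Real.cos_periodic.lift

/-- Sine on the circle. -/
def aSin : Circle2pi → ℝ := Real.sin_periodic.lift

/-- The torus action Φ_τ^H on phase space: rotation by angle τ_j in the (x_j, ξ_j)-plane. -/
def PhiT {d : ℕ} (τ : Torus d) (z : Pd d) : Pd d :=
  (fun j => aCos (τ j) * z.1 j + aSin (τ j) * z.2 j,
   fun j => -aSin (τ j) * z.1 j + aCos (τ j) * z.2 j)

/-- The one-parameter line t ↦ tω in the torus. -/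
def lineTorus {d : ℕ} (ω : Fin d → ℝ) (t : ℝ) : Torus d :=
  fun j => ((t * ω j : ℝ) : Circle2pi)

/-- The harmonic oscillator flow φ_t^H = Φ_{tω}^H. -/
def phiH {d : ℕ} (ω : Fin d → ℝ) (t : ℝ) (z : Pd d) : Pd d :=
  PhiT (lineTorus ω t) z

/-- G_ω : the closure in 𝕋^d of the orbit {tω}. -/
def Gomega {d : ℕ} (ω : Fin d → ℝ) : Set (Torus d) :=
  closure (Set.range (lineTorus ω))

/-- ν is the normalized Haar measure of the compact subgroup G_ω :
it is a probability measure, carried by G_ω, invariant under translation by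
elements of G_ω.  These properties determine it uniquely. -/
def IsHaarOnG {d : ℕ} (ω : Fin d → ℝ) (ν : Measure (Torus d)) : Prop :=
  IsProbabilityMeasure ν ∧ ν (Gomega ω)ᶜ = 0 ∧
    ∀ g ∈ Gomega ω, Measure.map (fun τ => g + τ) ν = ν

/-- The average ⟨a⟩ of a along the harmonic oscillator flow. -/
def avg {d : ℕ} (ν : Measure (Torus d)) (a : Pd d → ℂ) (z : Pd d) : ℂ :=
  ∫ τ, a (PhiT τ z) ∂ν

theorem ContinuousMap.intervalIntegrable_comp {X : Type*} [TopologicalSpace X] {γ : ℝ → X}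
    (hγ : Continuous γ) (f : C(X, ℂ)) (a b : ℝ) :
    IntervalIntegrable (fun t => f (γ t)) volume a b :=
  (f.continuous.comp hγ).intervalIntegrable a b

/-- The limit of the time averages `T⁻¹ ∫₀ᵀ f (γ t) dt` along a continuous curve `γ` exists and
equals the `ν`-mean of `f`. -/
def HasTimeAverage {X : Type*} [MeasurableSpace X] (γ : ℝ → X) (ν : Measure X) (f : X → ℂ) :
    Prop :=
  Tendsto (fun T : ℝ => (1 / (T : ℂ)) * ∫ t in (0:ℝ)..T, f (γ t)) atTop (𝓝 (∫ x, f x ∂ν))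

section HasTimeAverage

variable {X : Type*} [TopologicalSpace X] [CompactSpace X] [MeasurableSpace X] [BorelSpace X]
  {γ : ℝ → X} {ν : Measure X}

theorem ContinuousMap.integrable_of_compactSpace [IsFiniteMeasure ν] (f : C(X, ℂ)) :
    Integrable f ν :=
  f.continuous.integrable_of_hasCompactSupport (HasCompactSupport.of_compactSpace f)

/-- Uniform limits of functions with a time average have a time average. -/
theorem hasTimeAverage_of_mem_closure [IsProbabilityMeasure ν] (hγ : Continuous γ)
    {S : Set C(X, ℂ)} (hS : ∀ g ∈ S, HasTimeAverage γ ν g) {f : C(X, ℂ)} (hf : f ∈ closure S) :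
    HasTimeAverage γ ν f := by
  refine Metric.tendsto_nhds.2 fun ε hε => ?_
  obtain ⟨g, hg, hfg⟩ := Metric.mem_closure_iff.1 hf (ε / 3) (by positivity)
  rw [dist_eq_norm] at hfg
  have hpt : ∀ x, ‖f x - g x‖ ≤ ‖f - g‖ := fun x => (f - g).norm_coe_le_norm x
  have hspace : ‖∫ x, g x ∂ν - ∫ x, f x ∂ν‖ ≤ ‖f - g‖ := by
    rw [norm_sub_rev, ← integral_sub f.integrable_of_compactSpace g.integrable_of_compactSpace]
    simpa using norm_integral_le_of_norm_le_const (μ := ν) (Eventually.of_forall hpt)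
  filter_upwards [Metric.tendsto_nhds.1 (hS g hg) (ε / 3) (by positivity), eventually_gt_atTop 0]
    with T hT hT0
  have htime : ‖(1 / (T : ℂ)) * (∫ t in (0:ℝ)..T, f (γ t)) -
      (1 / (T : ℂ)) * ∫ t in (0:ℝ)..T, g (γ t)‖ ≤ ‖f - g‖ := by
    rw [← mul_sub, ← intervalIntegral.integral_sub (f.intervalIntegrable_comp hγ 0 T)
      (g.intervalIntegrable_comp hγ 0 T), norm_mul]
    have h := intervalIntegral.norm_integral_le_of_norm_le_const (a := 0) (b := T)
      (f := fun t => f (γ t) - g (γ t)) fun t _ => hpt (γ t)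
    rw [sub_zero, abs_of_pos hT0] at h
    have hn : ‖1 / (T : ℂ)‖ = 1 / T := by simp [abs_of_pos hT0]
    rw [hn, one_div, inv_mul_le_iff₀ hT0, mul_comm T]
    exact h
  rw [dist_eq_norm] at hT ⊢
  calc _ = ‖((1 / (T : ℂ)) * (∫ t in (0:ℝ)..T, f (γ t)) -
        (1 / (T : ℂ)) * ∫ t in (0:ℝ)..T, g (γ t)) +
        ((1 / (T : ℂ)) * (∫ t in (0:ℝ)..T, g (γ t)) - ∫ x, g x ∂ν) +
        (∫ x, g x ∂ν - ∫ x, f x ∂ν)‖ := by congr 1; ring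
    _ ≤ _ := norm_add₃_le
    _ < ε := by linarith

/-- Linear combinations of functions with a time average have a time average. -/
theorem hasTimeAverage_of_mem_span [IsFiniteMeasure ν] (hγ : Continuous γ)
    {S : Set C(X, ℂ)} (hS : ∀ g ∈ S, HasTimeAverage γ ν g) {f : C(X, ℂ)}
    (hf : f ∈ Submodule.span ℂ S) : HasTimeAverage γ ν f := by
  induction hf using Submodule.span_induction with
  | mem g hg => exact hS g hg
  | zero => simp [HasTimeAverage]
  | add f g _ _ hf hg =>
    have h := Tendsto.add hf hg
    rw [← integral_add f.integrable_of_compactSpace g.integrable_of_compactSpace] at h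
    refine h.congr fun T => ?_
    rw [← mul_add, ← intervalIntegral.integral_add (f.intervalIntegrable_comp hγ 0 T)
      (g.intervalIntegrable_comp hγ 0 T)]
    rfl
  | smul c f _ hf =>
    have h := Tendsto.const_mul c hf
    rw [← integral_const_mul] at h
    refine h.congr fun T => ?_
    simp only [ContinuousMap.smul_apply, smul_eq_mul, intervalIntegral.integral_const_mul]
    ring

end HasTimeAverage

theorem norm_exp_ofReal_mul_I_integral_le {c : ℝ} (hc : c ≠ 0) (T : ℝ) :
    ‖∫ t in (0:ℝ)..T, Complex.exp (c * Complex.I * t)‖ ≤ 2 / |c| := by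
  rw [integral_exp_mul_complex (by simp [hc]), norm_div]
  have hden : ‖(c : ℂ) * Complex.I‖ = |c| := by simp
  rw [hden]
  gcongr
  refine (norm_sub_le _ _).trans (le_of_eq ?_)
  have h : ∀ s : ℝ, ‖Complex.exp (c * Complex.I * s)‖ = 1 := fun s => by
    rw [show (c : ℂ) * Complex.I * s = ((c * s : ℝ) : ℂ) * Complex.I by push_cast; ring,
      Complex.norm_exp_ofReal_mul_I]
  rw [h, h]
  norm_num

theorem tendsto_average_exp_ofReal_mul_I {c : ℝ} (hc : c ≠ 0) :
    Tendsto (fun T : ℝ => (1 / (T : ℂ)) * ∫ t in (0:ℝ)..T, Complex.exp (c * Complex.I * t))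
      atTop (𝓝 0) := by
  refine squeeze_zero_norm' ?_ (tendsto_inv_atTop_zero.mul_const (2 / |c|) |>.trans_eq ?_)
  · filter_upwards [eventually_gt_atTop 0] with T hT
    rw [norm_mul]
    have hn : ‖1 / (T : ℂ)‖ = T⁻¹ := by simp [abs_of_pos hT]
    rw [hn]
    gcongr
    exact norm_exp_ofReal_mul_I_integral_le hc T
  · rw [zero_mul]

/-- The character of the torus with frequency vector `n`. -/
def torusCharacter {d : ℕ} (n : Fin d → ℤ) : C(Torus d, ℂ) where
  toFun τ := ∏ j, fourier (n j) (τ j)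
  continuous_toFun := by fun_prop

theorem torusCharacter_add {d : ℕ} (n : Fin d → ℤ) (σ τ : Torus d) :
    torusCharacter n (σ + τ) = torusCharacter n σ * torusCharacter n τ := by
  simp only [torusCharacter, ContinuousMap.coe_mk, ← Finset.prod_mul_distrib, Pi.add_apply]
  refine Finset.prod_congr rfl fun j _ => ?_
  rw [fourier_apply, fourier_apply, fourier_apply, zsmul_add, AddCircle.toCircle_add,
    Circle.coe_mul]

theorem torusCharacter_lineTorus {d : ℕ} (n : Fin d → ℤ) (ω : Fin d → ℝ) (t : ℝ) :
    torusCharacter n (lineTorus ω t) =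
      Complex.exp (((∑ j, n j * ω j : ℝ) : ℂ) * Complex.I * t) := by
  simp only [torusCharacter, ContinuousMap.coe_mk, lineTorus, fourier_coe_apply]
  rw [← Complex.exp_sum]
  congr 1
  push_cast
  rw [Finset.sum_mul, Finset.sum_mul]
  refine Finset.sum_congr rfl fun j _ => ?_
  have : (π : ℂ) ≠ 0 := by exact_mod_cast Real.pi_ne_zero
  field_simp

theorem continuous_lineTorus {d : ℕ} (ω : Fin d → ℝ) : Continuous (lineTorus ω) :=
  continuous_pi fun _ => (AddCircle.continuous_mk' _).comp (continuous_id.mul continuous_const)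

/-- The rescaling of `ℝ/2πℤ` to `ℝ/ℤ` in each coordinate. -/
def torusHomeomorph (d : ℕ) : Torus d ≃ₜ UnitAddTorus (Fin d) :=
  Homeomorph.piCongrRight fun _ =>
    AddCircle.homeomorphAddCircle (2 * π) 1 Real.two_pi_pos.ne' one_ne_zero

theorem mFourier_torusHomeomorph {d : ℕ} (n : Fin d → ℤ) (τ : Torus d) :
    UnitAddTorus.mFourier n (torusHomeomorph d τ) = torusCharacter n τ := by
  simp only [torusCharacter, UnitAddTorus.mFourier, ContinuousMap.coe_mk]
  refine Finset.prod_congr rfl fun j _ => ?_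
  change fourier (n j)
    (AddCircle.homeomorphAddCircle (2 * π) 1 Real.two_pi_pos.ne' one_ne_zero (τ j)) = _
  induction τ j using QuotientAddGroup.induction_on with
  | H x =>
    rw [AddCircle.homeomorphAddCircle_apply_mk, fourier_coe_apply, fourier_coe_apply]
    congr 1
    push_cast
    field_simp

/-- Trigonometric polynomials are uniformly dense in the continuous functions on the torus. -/
theorem mem_closure_span_torusCharacter {d : ℕ} (f : C(Torus d, ℂ)) :
    f ∈ closure (Submodule.span ℂ (Set.range (torusCharacter (d := d))) : Set C(Torus d, ℂ)) := by
  let e : C(Torus d, UnitAddTorus (Fin d)) := torusHomeomorph d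
  let F : C(UnitAddTorus (Fin d), ℂ) := f.comp (torusHomeomorph d).symm
  have hF : F ∈ closure (Submodule.span ℂ
      (Set.range (UnitAddTorus.mFourier (d := Fin d))) : Set C(UnitAddTorus (Fin d), ℂ)) := by
    rw [← Submodule.topologicalClosure_coe, UnitAddTorus.span_mFourier_closure_eq_top]
    trivial
  have hFe : F.comp e = f := by
    ext τ
    simp [F, e]
  rw [← hFe]
  refine map_mem_closure (f := fun g : C(UnitAddTorus (Fin d), ℂ) => g.comp e)
    (ContinuousMap.continuous_precomp e) hF fun g hg => ?_
  induction hg using Submodule.span_induction with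
  | mem g hg =>
    obtain ⟨n, rfl⟩ := hg
    exact Submodule.subset_span ⟨n, ContinuousMap.ext fun τ => (mFourier_torusHomeomorph n τ).symm⟩
  | zero => exact Submodule.zero_mem _
  | add g h _ _ hg hh => exact Submodule.add_mem _ hg hh
  | smul c g _ hg => exact Submodule.smul_mem _ c hg

/-- On `G_ω`, a character that is trivial along the line is trivial, and any other one has mean
zero by invariance; along the line it oscillates. -/
theorem hasTimeAverage_torusCharacter {d : ℕ} {ω : Fin d → ℝ} {ν : Measure (Torus d)}
    (hν : IsHaarOnG ω ν) (n : Fin d → ℤ) :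
    HasTimeAverage (lineTorus ω) ν (torusCharacter n) := by
  obtain ⟨_, hsupp, hinv⟩ := hν
  simp only [HasTimeAverage, torusCharacter_lineTorus]
  set c : ℝ := ∑ j, n j * ω j with hc_def
  by_cases hc : c = 0
  · have hone : ∀ τ ∈ Gomega ω, torusCharacter n τ = 1 := by
      refine closure_minimal (t := {τ | torusCharacter n τ = 1}) ?_
        (isClosed_eq (torusCharacter n).continuous continuous_const)
      rintro _ ⟨t, rfl⟩
      simp [torusCharacter_lineTorus, ← hc_def, hc]
    have hae : ∀ᵐ τ ∂ν, torusCharacter n τ = 1 :=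
      measure_mono_null (fun τ hτ hG => hτ (hone τ hG)) hsupp
    rw [integral_congr_ae hae]
    refine tendsto_const_nhds.congr' ?_
    filter_upwards [eventually_gt_atTop 0] with T hT
    simp [hc, hT.ne']
  · have hmean : ∫ τ, torusCharacter n τ ∂ν = 0 := by
      set g : Torus d := lineTorus ω (π / c)
      have hg : torusCharacter n g = -1 := by
        rw [torusCharacter_lineTorus, ← hc_def, ← Complex.exp_pi_mul_I]
        congr 1
        have : (c : ℂ) ≠ 0 := by exact_mod_cast hc
        push_cast
        field_simp
      have h : ∫ τ, torusCharacter n τ ∂ν = -∫ τ, torusCharacter n τ ∂ν := by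
        conv_lhs => rw [← hinv g (subset_closure ⟨_, rfl⟩)]
        rw [integral_map (by fun_prop)
          (torusCharacter n).continuous.aestronglyMeasurable]
        simp [torusCharacter_add, hg, integral_neg]
      exact self_eq_neg.1 h
    rw [hmean]
    exact tendsto_average_exp_ofReal_mul_I hc

theorem continuous_PhiT {d : ℕ} (z : Pd d) : Continuous fun τ : Torus d => PhiT τ z := by
  have hcos : Continuous aCos := continuous_quot_lift _ Real.continuous_cos
  have hsin : Continuous aSin := continuous_quot_lift _ Real.continuous_sin
  unfold PhiT
  fun_prop

/-- For bounded continuous a, the time average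
(1/T)∫_0^T a(φ_t^H(z)) dt converges as T → ∞ to ⟨a⟩(z) = ∫_{G_ω} a(Φ_τ^H(z)) dν_ω(τ). -/
theorem time_average_tendsto_avg {d : ℕ} (hd : 1 ≤ d) (ω : Fin d → ℝ) (hω : ∀ j, 0 < ω j)
    (ν : Measure (Torus d)) (hν : IsHaarOnG ω ν)
    (a : Pd d → ℂ) (ha_cont : Continuous a) (ha_bdd : ∃ M, ∀ z, ‖a z‖ ≤ M)
    (z : Pd d) :
    Tendsto (fun T : ℝ => (1 / (T : ℂ)) * ∫ t in (0:ℝ)..T, a (phiH ω t z))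
      atTop (𝓝 (avg ν a z)) := by
  have := hν.1
  let f : C(Torus d, ℂ) := ⟨fun τ => a (PhiT τ z), ha_cont.comp (continuous_PhiT z)⟩
  have hγ := continuous_lineTorus ω
  exact hasTimeAverage_of_mem_closure (f := f) hγ
    (fun g hg => hasTimeAverage_of_mem_span hγ
      (Set.forall_mem_range.2 (hasTimeAverage_torusCharacter hν)) hg)
    (mem_closure_span_torusCharacter f)

end
end

section
/- Let s > 0, ℏ > 0, and let σ₁ > 0, σ₂ > 0 with σ₁ + σ₂ < s. For all a, b ∈ A_s, the Moyal commutator [a,b]_ℏ belongs to A_{s−σ₁−σ₂} and ‖[a,b]_ℏ‖_{s−σ₁−σ₂} ≤ (2ℏ / (e² σ₁(σ₁+σ₂))) ‖a‖_s ‖b‖_{s−σ₂}. -/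
open MeasureTheory Real Filter Topology
open scoped ENNReal BigOperators

noncomputable section

/-- The standard symplectic form ς((x,ξ),(y,η)) = ξ·y − x·η. -/
def symp {d : ℕ} (w v : Pd d) : ℝ :=
  (∑ j, w.2 j * v.1 j) - ∑ j, w.1 j * v.2 j

/-- The Moyal product a ♯_ℏ b. -/
def moyal {d : ℕ} (ℏ : ℝ) (a b : Pd d → ℂ) (z : Pd d) : ℂ :=
  (((2 * Real.pi) ^ (4 * d) : ℝ) : ℂ)⁻¹ *
    ∫ p : Pd d × Pd d,
      fourierT a p.1 * fourierT b (p.2 - p.1) *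
        Complex.exp (Complex.I * ℏ / 2 * (symp p.1 (p.2 - p.1) : ℝ)) *
        Complex.exp (Complex.I * (dotP p.2 z : ℝ))

/-- The Moyal commutator [a,b]_ℏ = a ♯_ℏ b − b ♯_ℏ a. -/
def moyalComm {d : ℕ} (ℏ : ℝ) (a b : Pd d → ℂ) : Pd d → ℂ :=
  fun z => moyal ℏ a b z - moyal ℏ b a z

/-- Coordinate vector in the x_j direction. -/
def ex {d : ℕ} (j : Fin d) : Pd d := (Pi.single j 1, 0)

/-- Coordinate vector in the ξ_j direction. -/
def exi {d : ℕ} (j : Fin d) : Pd d := (0, Pi.single j 1)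

/-- Directional derivative of a complex-valued symbol. -/
def pdC {d : ℕ} (v : Pd d) (f : Pd d → ℂ) (z : Pd d) : ℂ := fderiv ℝ f z v

/-- The Poisson bracket {a,b} = Σ_j (∂_{ξ_j}a ∂_{x_j}b − ∂_{x_j}a ∂_{ξ_j}b). -/
def poisson {d : ℕ} (a b : Pd d → ℂ) (z : Pd d) : ℂ :=
  ∑ j, (pdC (exi j) a z * pdC (ex j) b z - pdC (ex j) a z * pdC (exi j) b z)

/-- Iterated Moyal adjoint Ad_G^{♯ℏ,j}(a). -/
def adM {d : ℕ} (ℏ : ℝ) (G : Pd d → ℂ) : ℕ → (Pd d → ℂ) → (Pd d → ℂ)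
  | 0, a => a
  | j + 1, a => moyalComm ℏ G (adM ℏ G j a)

/-- The j-th term of the series defining Ψ_t^{G,ℏ} a. -/
def psiTerm {d : ℕ} (t ℏ : ℝ) (G a : Pd d → ℂ) (j : ℕ) : Pd d → ℂ :=
  fun z => ((Complex.I * t / ℏ) ^ j / (j.factorial : ℂ)) * adM ℏ G j a z

/-- Ψ_t^{G,ℏ} a = Σ_j (1/j!)(it/ℏ)^j Ad_G^{♯ℏ,j}(a). -/
def Psi {d : ℕ} (t ℏ : ℝ) (G a : Pd d → ℂ) (z : Pd d) : ℂ :=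
  ∑' j : ℕ, psiTerm t ℏ G a j z

section Inversion

variable {V : Type*} [NormedAddCommGroup V] [InnerProductSpace ℝ V] [FiniteDimensional ℝ V]
  [MeasurableSpace V] [BorelSpace V]

open scoped FourierTransform RealInnerProductSpace

/-- **Fourier inversion** almost everywhere, for integrable functions with integrable transform. -/
theorem fourierInv_fourier_ae_eq {f : V → ℂ} (hf : Integrable f) (hFf : Integrable (𝓕 f)) :
    𝓕⁻ (𝓕 f) =ᵐ[volume] f := by
  have hL : Continuous fun p : V × V => (-innerₗ V) p.1 p.2 := continuous_inner.neg
  have hcont : Continuous (𝓕⁻ (𝓕 f)) :=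
    VectorFourier.fourierIntegral_continuous Real.continuous_fourierChar hL hFf
  refine ae_eq_of_integral_contDiff_smul_eq hcont.locallyIntegrable hf.locallyIntegrable ?_
  intro φ hφ hφc
  let ψ : SchwartzMap V ℂ := HasCompactSupport.toSchwartzMap (f := fun x => (φ x : ℂ))
    (hφc.comp_left (g := ((↑) : ℝ → ℂ)) Complex.ofReal_zero)
    (Complex.ofRealCLM.contDiff.comp hφ)
  have hψ : ∀ x, ψ x = (φ x : ℂ) := fun x => rfl
  have h1 : ∫ x, (𝓕⁻ (ψ : V → ℂ)) x • (𝓕 f) x = ∫ x, ψ x • (𝓕⁻ (𝓕 f)) x := by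
    have := VectorFourier.integral_fourierIntegral_smul_eq_flip (L := -innerₗ V) (μ := volume)
      (ν := volume) Real.continuous_fourierChar hL ψ.integrable hFf
    rwa [show (-innerₗ V).flip = -innerₗ V by ext; simp [real_inner_comm]] at this
  have h2 : ∫ x, (𝓕 (𝓕⁻ ψ : SchwartzMap V ℂ) : SchwartzMap V ℂ) x • f x
      = ∫ x, (𝓕⁻ ψ : SchwartzMap V ℂ) x • (𝓕 f) x := by
    have := VectorFourier.integral_fourierIntegral_smul_eq_flip (L := innerₗ V) (μ := volume)
      (ν := volume) Real.continuous_fourierChar continuous_inner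
      (𝓕⁻ ψ : SchwartzMap V ℂ).integrable hf
    rwa [flip_innerₗ] at this
  rw [FourierTransform.fourier_fourierInv_eq] at h2
  have h3 : ∀ x, (𝓕⁻ ψ : SchwartzMap V ℂ) x = (𝓕⁻ (ψ : V → ℂ)) x := fun x => by
    rw [← SchwartzMap.fourierInv_coe]
  simp only [h3] at h2
  rw [h1] at h2
  simpa [hψ] using h2.symm

end Inversion

/-- The identification of the Euclidean space `ℝ^{2d}` with phase space. -/
def euclPd (d : ℕ) : EuclideanSpace ℝ (Fin d ⊕ Fin d) ≃ᵐ Pd d :=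
  (MeasurableEquiv.toLp 2 (Fin d ⊕ Fin d → ℝ)).symm.trans
    (MeasurableEquiv.sumPiEquivProdPi fun _ => ℝ)

theorem measurePreserving_euclPd (d : ℕ) : MeasurePreserving (euclPd d) :=
  (volume_measurePreserving_sumPiEquivProdPi fun _ => ℝ).comp
    (EuclideanSpace.volume_preserving_symm_measurableEquiv_toLp _)

theorem euclPd_apply {d : ℕ} (x : EuclideanSpace ℝ (Fin d ⊕ Fin d)) :
    euclPd d x = (fun j => x (Sum.inl j), fun j => x (Sum.inr j)) := rfl

theorem euclPd_symm_apply {d : ℕ} (z : Pd d) :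
    (euclPd d).symm z = WithLp.toLp 2 (Sum.elim z.1 z.2) := by
  rw [MeasurableEquiv.symm_apply_eq]; rfl

theorem inner_eq_dotP {d : ℕ} (x y : EuclideanSpace ℝ (Fin d ⊕ Fin d)) :
    inner ℝ x y = dotP (euclPd d x) (euclPd d y) := by
  simp [PiLp.inner_apply, dotP, euclPd_apply, mul_comm]

theorem normP_eq_norm {d : ℕ} (z : Pd d) : normP z = ‖(euclPd d).symm z‖ := by
  simp [EuclideanSpace.norm_eq, normP, euclPd_symm_apply]

theorem normP_add_le {d : ℕ} (z w : Pd d) : normP (z + w) ≤ normP z + normP w := by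
  have h : (euclPd d).symm (z + w) = (euclPd d).symm z + (euclPd d).symm w := by
    simp only [euclPd_symm_apply]
    ext (j | j) <;> simp
  simpa only [normP_eq_norm, h] using norm_add_le ((euclPd d).symm z) ((euclPd d).symm w)

theorem abs_dotP_le {d : ℕ} (z w : Pd d) : |dotP z w| ≤ normP z * normP w := by
  simpa [normP_eq_norm, inner_eq_dotP] using
    abs_real_inner_le_norm ((euclPd d).symm z) ((euclPd d).symm w)

theorem normP_nonneg {d : ℕ} (z : Pd d) : 0 ≤ normP z := Real.sqrt_nonneg _

@[fun_prop]
theorem continuous_normP {d : ℕ} : Continuous (normP (d := d)) := by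
  unfold normP; fun_prop

@[fun_prop]
theorem continuous_dotP {d : ℕ} {X : Type*} [TopologicalSpace X] {f g : X → Pd d}
    (hf : Continuous f) (hg : Continuous g) : Continuous fun x => dotP (f x) (g x) := by
  unfold dotP; fun_prop

@[fun_prop]
theorem continuous_symp {d : ℕ} {X : Type*} [TopologicalSpace X] {f g : X → Pd d}
    (hf : Continuous f) (hg : Continuous g) : Continuous fun x => symp (f x) (g x) := by
  unfold symp; fun_prop

theorem dotP_comm {d : ℕ} (w z : Pd d) : dotP w z = dotP z w := by
  simp [dotP, mul_comm]

theorem dotP_add_right {d : ℕ} (w z z' : Pd d) : dotP w (z + z') = dotP w z + dotP w z' := by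
  simp [dotP, mul_add, Finset.sum_add_distrib]; ring

theorem dotP_add_left {d : ℕ} (w w' z : Pd d) : dotP (w + w') z = dotP w z + dotP w' z := by
  simp [dotP, add_mul, Finset.sum_add_distrib]; ring

theorem dotP_sub_left {d : ℕ} (w w' z : Pd d) : dotP (w - w') z = dotP w z - dotP w' z := by
  simp [dotP, sub_mul, Finset.sum_sub_distrib]; ring

theorem dotP_smul_right {d : ℕ} (c : ℝ) (w z : Pd d) : dotP w (c • z) = c * dotP w z := by
  simp [dotP, Finset.mul_sum, mul_add, mul_left_comm]

theorem norm_cexp_I_mul_dotP {d : ℕ} (w z : Pd d) :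
    ‖Complex.exp (Complex.I * (dotP w z : ℝ))‖ = 1 := by
  rw [mul_comm, Complex.norm_exp_ofReal_mul_I]

theorem norm_cexp_neg_I_mul_dotP {d : ℕ} (w z : Pd d) :
    ‖Complex.exp (-(Complex.I * (dotP w z : ℝ)))‖ = 1 := by
  rw [mul_comm, ← neg_mul, ← Complex.ofReal_neg, Complex.norm_exp_ofReal_mul_I]

@[fun_prop]
theorem continuous_fourierT {d : ℕ} {a : Pd d → ℂ} (ha : Integrable a) :
    Continuous (fourierT a) := by
  refine continuous_of_dominated (bound := fun z => ‖a z‖) (fun w => ?_) (fun w => ?_) ha.norm ?_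
  · exact (Continuous.aestronglyMeasurable (by fun_prop)).mul ha.1
  · exact ae_of_all _ fun z => by rw [norm_mul, norm_cexp_neg_I_mul_dotP, one_mul]
  · exact ae_of_all _ fun z => by fun_prop

section Inversion

open scoped FourierTransform RealInnerProductSpace

theorem fourier_comp_euclPd {d : ℕ} (g : Pd d → ℂ) (v : EuclideanSpace ℝ (Fin d ⊕ Fin d)) :
    𝓕 (g ∘ euclPd d) v = fourierT g (euclPd d ((2 * π) • v)) := by
  rw [Real.fourier_eq', fourierT, ← (measurePreserving_euclPd d).integral_comp
    (euclPd d).measurableEmbedding]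
  congr 1 with x
  rw [← inner_eq_dotP, real_inner_smul_left, real_inner_comm]
  simp only [Function.comp_apply, smul_eq_mul]
  congr 2
  push_cast
  ring

/-- Fourier inversion for the transform `fourierT`, almost everywhere. -/
theorem fourierT_inversion_ae {d : ℕ} {g : Pd d → ℂ} (hg : Integrable g)
    (hG : Integrable (fourierT g)) :
    (fun z => ∫ w, fourierT g w * Complex.exp (Complex.I * (dotP w z : ℝ))) =ᵐ[volume]
      fun z => (((2 * π) ^ (2 * d) : ℝ) : ℂ) * g z := by
  have he := measurePreserving_euclPd d
  have hemb := (euclPd d).measurableEmbedding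
  have h1 : Integrable (g ∘ euclPd d) := (he.integrable_comp_emb hemb).2 hg
  have h2 : Integrable (𝓕 (g ∘ euclPd d)) := by
    have : Integrable (fourierT g ∘ euclPd d) := (he.integrable_comp_emb hemb).2 hG
    exact (this.comp_smul two_pi_pos.ne').congr
      (ae_of_all _ fun v => (fourier_comp_euclPd g v).symm)
  have h3 := fourierInv_fourier_ae_eq h1 h2
  have h4 := (he.symm (euclPd d)).quasiMeasurePreserving.ae h3
  filter_upwards [h4] with z hz
  rw [Function.comp_apply, MeasurableEquiv.apply_symm_apply, Real.fourierInv_eq'] at hz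
  rw [← hz, ← he.integral_comp hemb]
  have h5 := Measure.integral_comp_smul (volume : Measure (EuclideanSpace ℝ (Fin d ⊕ Fin d)))
    (fun w => fourierT g (euclPd d w) * Complex.exp (Complex.I * (dotP (euclPd d w) z : ℝ)))
    (2 * π)
  have h6 : ∀ v : EuclideanSpace ℝ (Fin d ⊕ Fin d),
      Complex.exp (((2 * π * ⟪v, (euclPd d).symm z⟫ : ℝ) : ℂ) * Complex.I) •
        𝓕 (g ∘ euclPd d) v = fourierT g (euclPd d ((2 * π) • v)) *
          Complex.exp (Complex.I * (dotP (euclPd d ((2 * π) • v)) z : ℝ)) := by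
    intro v
    rw [fourier_comp_euclPd, smul_eq_mul, mul_comm, mul_comm _ Complex.I]
    congr 4
    have := inner_eq_dotP ((2 * π) • v) ((euclPd d).symm z)
    rw [MeasurableEquiv.apply_symm_apply, real_inner_smul_left] at this
    exact this
  simp only [h6]
  rw [h5, finrank_euclideanSpace, Fintype.card_sum, Fintype.card_fin, ← two_mul,
    abs_of_pos (by positivity), Complex.real_smul, ← mul_assoc, ← Complex.ofReal_mul,
    mul_inv_cancel₀ (by positivity), Complex.ofReal_one, one_mul]

end Inversion

instance isAddHaarMeasure_volume_Pd {d : ℕ} : (volume : Measure (Pd d)).IsAddHaarMeasure :=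
  Measure.prod.instIsAddHaarMeasure (volume : Measure (Fin d → ℝ)) volume

instance isNegInvariant_volume_Pd {d : ℕ} : (volume : Measure (Pd d)).IsNegInvariant :=
  ⟨((Measure.measurePreserving_neg (volume : Measure (Fin d → ℝ))).prod
    (Measure.measurePreserving_neg (volume : Measure (Fin d → ℝ)))).map_eq⟩

/-- The rotation `(x, ξ) ↦ (ξ, -x)` of phase space, which represents the symplectic form. -/
def rotP {d : ℕ} (w : Pd d) : Pd d := (w.2, -w.1)

@[fun_prop]
theorem continuous_rotP {d : ℕ} : Continuous (rotP (d := d)) := by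
  unfold rotP; fun_prop

theorem symp_eq_dotP_rotP {d : ℕ} (w v : Pd d) : symp w v = dotP v (rotP w) := by
  simp [symp, dotP, rotP, mul_comm, sub_eq_add_neg]

theorem symp_sub_swap {d : ℕ} (w ζ : Pd d) : symp (ζ - w) w = -symp w (ζ - w) := by
  simp only [symp, Prod.fst_sub, Prod.snd_sub, Pi.sub_apply, neg_sub]
  congr 1 <;> exact Finset.sum_congr rfl fun j _ => mul_comm _ _

theorem normP_rotP {d : ℕ} (w : Pd d) : normP (rotP w) = normP w := by
  simp [normP, rotP, add_comm]

theorem abs_symp_le {d : ℕ} (w v : Pd d) : |symp w v| ≤ normP w * normP v := by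
  rw [symp_eq_dotP_rotP, dotP_comm]
  simpa [normP_rotP] using abs_dotP_le (rotP w) v

/-- The unnormalized inverse Fourier integral `∫ e^{i v·z} f(v) dv`. -/
def invFourierT {d : ℕ} (f : Pd d → ℂ) (z : Pd d) : ℂ :=
  ∫ v, f v * Complex.exp (Complex.I * (dotP v z : ℝ))

theorem fourierT_congr_ae {d : ℕ} {f g : Pd d → ℂ} (h : f =ᵐ[volume] g) :
    fourierT f = fourierT g := by
  ext w
  refine integral_congr_ae ?_
  filter_upwards [h] with z hz
  rw [hz]

theorem fourierT_const_mul {d : ℕ} (c : ℂ) (f : Pd d → ℂ) (w : Pd d) :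
    fourierT (fun z => c * f z) w = c * fourierT f w := by
  simp only [fourierT, mul_left_comm _ c, integral_const_mul]

theorem integrable_invFourierT_fourierT {d : ℕ} {b : Pd d → ℂ} (hb : Integrable b)
    (hB : Integrable (fourierT b)) : Integrable (invFourierT (fourierT b)) :=
  (hb.const_mul _).congr (fourierT_inversion_ae hb hB).symm

theorem fourierT_invFourierT_fourierT {d : ℕ} {b : Pd d → ℂ} (hb : Integrable b)
    (hB : Integrable (fourierT b)) (w : Pd d) :
    fourierT (invFourierT (fourierT b)) w = (((2 * π) ^ (2 * d) : ℝ) : ℂ) * fourierT b w := by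
  rw [← fourierT_const_mul]
  exact congrFun (fourierT_congr_ae (fourierT_inversion_ae hb hB)) w

theorem fourierT_comp_add_right {d : ℕ} (f : Pd d → ℂ) (ζ y : Pd d) :
    fourierT (fun z => f (z + y)) ζ =
      Complex.exp (Complex.I * (dotP ζ y : ℝ)) * fourierT f ζ := by
  rw [fourierT, fourierT, ← integral_const_mul,
    ← integral_add_right_eq_self (μ := volume)
      (fun z => Complex.exp (Complex.I * (dotP ζ y : ℝ)) *
        (Complex.exp (-(Complex.I * (dotP ζ z : ℝ))) * f z)) y]
  congr 1 with z
  rw [← mul_assoc, ← Complex.exp_add, dotP_add_right]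
  congr 2
  push_cast
  ring

theorem moyal_eq_integral {d : ℕ} (ℏ : ℝ) {a b : Pd d → ℂ} (hA : Integrable (fourierT a))
    (hB : Integrable (fourierT b)) (z : Pd d) :
    moyal ℏ a b z = (((2 * π) ^ (4 * d) : ℝ) : ℂ)⁻¹ *
      ∫ w, fourierT a w * Complex.exp (Complex.I * (dotP w z : ℝ)) *
        invFourierT (fourierT b) (z + (ℏ / 2) • rotP w) := by
  unfold moyal
  congr 1
  have hmp : MeasurePreserving (MeasurableEquiv.shearAddRight (Pd d)) :=
    measurePreserving_prod_add volume volume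
  rw [← hmp.integral_comp (MeasurableEquiv.measurableEmbedding _)]
  have hpt : ∀ w v : Pd d, fourierT a w * fourierT b v *
      Complex.exp (Complex.I * ((dotP w z + dotP v (z + (ℏ / 2) • rotP w) : ℝ) : ℂ)) =
      fourierT a w * Complex.exp (Complex.I * (dotP w z : ℝ)) *
        (fourierT b v * Complex.exp (Complex.I * (dotP v (z + (ℏ / 2) • rotP w) : ℝ))) := by
    intro w v
    rw [Complex.ofReal_add, mul_add, Complex.exp_add]
    ring
  trans ∫ p : Pd d × Pd d, fourierT a p.1 * fourierT b p.2 *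
      Complex.exp (Complex.I * ((dotP p.1 z + dotP p.2 (z + (ℏ / 2) • rotP p.1) : ℝ) : ℂ))
  · congr 1 with p
    change fourierT a p.1 * fourierT b (p.1 + p.2 - p.1) * _ * Complex.exp
      (Complex.I * (dotP (p.1 + p.2) z : ℝ)) = _
    rw [mul_assoc, ← Complex.exp_add]
    change _ * Complex.exp (Complex.I * ℏ / 2 * (symp p.1 (p.1 + p.2 - p.1) : ℝ) + _) = _
    rw [add_sub_cancel_left, symp_eq_dotP_rotP, dotP_add_left, dotP_add_right, dotP_smul_right]
    congr 2
    push_cast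
    ring
  · rw [Measure.volume_eq_prod, integral_prod]
    · congr 1 with w
      simp only [hpt]
      rw [integral_const_mul, invFourierT]
    · refine (hA.mul_prod hB).mul_bdd (c := 1) (Continuous.aestronglyMeasurable (by fun_prop)) ?_
      refine ae_of_all _ fun p => le_of_eq ?_
      rw [mul_comm, Complex.norm_exp_ofReal_mul_I]

theorem integrable_mul_exp_mul_comp_shear {d : ℕ} (c : ℝ) {f h : Pd d → ℂ} (hf : Integrable f)
    (hh : Integrable h) :
    Integrable (fun p : Pd d × Pd d => f p.1 * Complex.exp (Complex.I * (dotP p.1 p.2 : ℝ)) *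
      h (p.2 + c • rotP p.1)) (volume.prod volume) := by
  have hmp : MeasurePreserving (fun p : Pd d × Pd d => (p.1, p.2 + c • rotP p.1))
      (volume.prod volume) (volume.prod volume) := by
    refine (MeasurePreserving.id volume).skew_product
      (g := fun w z => z + c • rotP w) ?_ ?_
    · exact Continuous.measurable (by fun_prop)
    · exact ae_of_all _ fun w => (measurePreserving_add_right volume (c • rotP w)).map_eq
  have h1 := hmp.integrable_comp_of_integrable (hf.mul_prod hh)
  refine (h1.bdd_mul (c := 1) (f := fun p : Pd d × Pd d => Complex.exp (Complex.I * (dotP p.1 p.2 : ℝ)))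
    (Continuous.aestronglyMeasurable (by fun_prop)) ?_).congr (ae_of_all _ fun p => ?_)
  · exact ae_of_all _ fun p => (norm_cexp_I_mul_dotP _ _).le
  · simp only [Function.comp_apply]
    ring

theorem integrable_moyal {d : ℕ} (ℏ : ℝ) {a b : Pd d → ℂ} (hA : Integrable (fourierT a))
    (hb : Integrable b) (hB : Integrable (fourierT b)) : Integrable (moyal ℏ a b) := by
  rw [funext (moyal_eq_integral ℏ hA hB)]
  exact (integrable_mul_exp_mul_comp_shear _ hA
    (integrable_invFourierT_fourierT hb hB)).integral_prod_right.const_mul _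

/-- The Fourier transform turns the Moyal product into a twisted convolution. -/
theorem fourierT_moyal {d : ℕ} (ℏ : ℝ) {a b : Pd d → ℂ} (hA : Integrable (fourierT a))
    (hb : Integrable b) (hB : Integrable (fourierT b)) (ζ : Pd d) :
    fourierT (moyal ℏ a b) ζ = (((2 * π) ^ (2 * d) : ℝ) : ℂ)⁻¹ *
      ∫ w, fourierT a w * fourierT b (ζ - w) *
        Complex.exp (Complex.I * ℏ / 2 * (symp w (ζ - w) : ℝ)) := by
  rw [funext (moyal_eq_integral ℏ hA hB), fourierT_const_mul]
  have hInt := integrable_mul_exp_mul_comp_shear (ℏ / 2) hA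
    (integrable_invFourierT_fourierT hb hB)
  have hInt_swap : Integrable (Function.uncurry fun z w : Pd d =>
      Complex.exp (-(Complex.I * (dotP ζ z : ℝ))) *
        (fourierT a w * Complex.exp (Complex.I * (dotP w z : ℝ)) *
          invFourierT (fourierT b) (z + (ℏ / 2) • rotP w))) (volume.prod volume) := by
    refine hInt.swap.bdd_mul (c := 1) (f := fun p : Pd d × Pd d =>
      Complex.exp (-(Complex.I * (dotP ζ p.1 : ℝ))))
      (Continuous.aestronglyMeasurable (by fun_prop)) ?_
    exact ae_of_all _ fun p => (norm_cexp_neg_I_mul_dotP _ _).le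
  have hinner : ∀ w : Pd d, ∫ z, Complex.exp (-(Complex.I * (dotP ζ z : ℝ))) *
        (fourierT a w * Complex.exp (Complex.I * (dotP w z : ℝ)) *
          invFourierT (fourierT b) (z + (ℏ / 2) • rotP w)) =
      (((2 * π) ^ (2 * d) : ℝ) : ℂ) * (fourierT a w * fourierT b (ζ - w) *
        Complex.exp (Complex.I * ℏ / 2 * (symp w (ζ - w) : ℝ))) := by
    intro w
    have h1 := fourierT_comp_add_right (invFourierT (fourierT b)) (ζ - w) ((ℏ / 2) • rotP w)
    rw [fourierT_invFourierT_fourierT hb hB, dotP_smul_right, ← symp_eq_dotP_rotP,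
      fourierT] at h1
    trans fourierT a w * ∫ z, Complex.exp (-(Complex.I * (dotP (ζ - w) z : ℝ))) *
        invFourierT (fourierT b) (z + (ℏ / 2) • rotP w)
    · rw [← integral_const_mul]
      congr 1 with z
      have : Complex.exp (-(Complex.I * (dotP (ζ - w) z : ℝ))) =
          Complex.exp (-(Complex.I * (dotP ζ z : ℝ))) *
            Complex.exp (Complex.I * (dotP w z : ℝ)) := by
        rw [← Complex.exp_add, dotP_sub_left]
        congr 1
        push_cast
        ring
      rw [this]
      ring
    · rw [h1, show Complex.I * ((ℏ / 2 * symp w (ζ - w) : ℝ) : ℂ) =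
        Complex.I * ℏ / 2 * (symp w (ζ - w) : ℝ) by push_cast; ring]
      ring
  have hswap : fourierT (fun z => ∫ w, fourierT a w * Complex.exp (Complex.I * (dotP w z : ℝ)) *
      invFourierT (fourierT b) (z + (ℏ / 2) • rotP w)) ζ = (((2 * π) ^ (2 * d) : ℝ) : ℂ) *
        ∫ w, fourierT a w * fourierT b (ζ - w) *
          Complex.exp (Complex.I * ℏ / 2 * (symp w (ζ - w) : ℝ)) := by
    rw [fourierT]
    simp only [← integral_const_mul]
    rw [integral_integral_swap hInt_swap]
    simp only [hinner]
  have hpi : (((2 * π) ^ (2 * d) : ℝ) : ℂ) ≠ 0 := by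
    exact_mod_cast (by positivity : ((2 * π) ^ (2 * d) : ℝ) ≠ 0)
  rw [hswap, show 4 * d = 2 * d + 2 * d by ring, pow_add, Complex.ofReal_mul, mul_inv,
    mul_assoc, inv_mul_cancel_left₀ hpi]

/-- The Fourier transform of the Moyal commutator. -/
theorem fourierT_moyalComm {d : ℕ} (ℏ : ℝ) {a b : Pd d → ℂ} (ha : Integrable a)
    (hA : Integrable (fourierT a)) (hb : Integrable b) (hB : Integrable (fourierT b))
    (ζ : Pd d) :
    fourierT (moyalComm ℏ a b) ζ = (((2 * π) ^ (2 * d) : ℝ) : ℂ)⁻¹ *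
      ((∫ w, fourierT a w * fourierT b (ζ - w) *
          Complex.exp (((ℏ / 2 * symp w (ζ - w) : ℝ) : ℂ) * Complex.I)) -
        ∫ w, fourierT a w * fourierT b (ζ - w) *
          Complex.exp (((-(ℏ / 2 * symp w (ζ - w)) : ℝ) : ℂ) * Complex.I)) := by
  have hsub : fourierT (moyalComm ℏ a b) ζ =
      fourierT (moyal ℏ a b) ζ - fourierT (moyal ℏ b a) ζ := by
    have hexp : ∀ {f : Pd d → ℂ}, Integrable f →
        Integrable fun z => Complex.exp (-(Complex.I * (dotP ζ z : ℝ))) * f z := fun hf =>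
      hf.bdd_mul (c := 1) (Continuous.aestronglyMeasurable (by fun_prop))
        (ae_of_all _ fun z => (norm_cexp_neg_I_mul_dotP _ _).le)
    unfold fourierT
    rw [← integral_sub (hexp (integrable_moyal ℏ hA hb hB)) (hexp (integrable_moyal ℏ hB ha hA))]
    simp only [moyalComm, mul_sub]
  rw [hsub, fourierT_moyal ℏ hA hb hB, fourierT_moyal ℏ hB ha hA, ← mul_sub]
  congr 2
  · congr 1 with w
    congr 2
    push_cast
    ring
  · rw [← integral_sub_left_eq_self _ volume ζ]
    congr 1 with w
    rw [sub_sub_cancel, symp_sub_swap, mul_comm (fourierT b _)]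
    congr 2
    push_cast
    ring

theorem norm_cexp_sub_cexp_neg_le (x : ℝ) :
    ‖Complex.exp (x * Complex.I) - Complex.exp (((-x : ℝ) : ℂ) * Complex.I)‖ ≤ 2 * |x| := by
  have h : Complex.exp (x * Complex.I) - Complex.exp (((-x : ℝ) : ℂ) * Complex.I) =
      ((2 * Real.sin x : ℝ) : ℂ) * Complex.I := by
    rw [Complex.exp_mul_I, Complex.exp_mul_I]
    push_cast
    simp only [Complex.cos_neg, Complex.sin_neg]
    ring
  rw [h, norm_mul, Complex.norm_I, mul_one, Complex.norm_real, Real.norm_eq_abs, abs_mul,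
    abs_two]
  exact mul_le_mul_of_nonneg_left Real.abs_sin_le_abs zero_le_two

theorem enorm_fourierT_moyalComm_le {d : ℕ} {ℏ : ℝ} (hℏ : 0 ≤ ℏ) {a b : Pd d → ℂ}
    (ha : Integrable a) (hA : Integrable (fourierT a)) (hb : Integrable b)
    (hB : Integrable (fourierT b)) (ζ : Pd d) :
    ‖fourierT (moyalComm ℏ a b) ζ‖ₑ ≤ ∫⁻ w, ENNReal.ofReal
      (ℏ * (‖fourierT a w‖ * normP w) * (‖fourierT b (ζ - w)‖ * normP (ζ - w))) := by
  have hbdd : ∃ C, ∀ v, ‖fourierT b v‖ ≤ C := by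
    refine ⟨∫ z, ‖b z‖, fun v => (norm_integral_le_integral_norm _).trans_eq ?_⟩
    simp only [norm_mul, norm_cexp_neg_I_mul_dotP, one_mul]
  obtain ⟨C, hC⟩ := hbdd
  have hInt : ∀ g : Pd d → ℝ, Continuous g → Integrable fun w =>
      fourierT a w * fourierT b (ζ - w) * Complex.exp ((g w : ℂ) * Complex.I) := by
    intro g hg
    have hcont := continuous_fourierT hb
    refine (hA.mul_bdd (c := C) (Continuous.aestronglyMeasurable ?_)
      (ae_of_all _ fun w => hC (ζ - w))).mul_bdd (c := 1)
      (Continuous.aestronglyMeasurable ?_) (ae_of_all _ fun w => ?_)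
    · fun_prop
    · fun_prop
    · rw [Complex.norm_exp_ofReal_mul_I]
  have hpi : ‖(((2 * π) ^ (2 * d) : ℝ) : ℂ)⁻¹‖ₑ ≤ 1 := by
    rw [← ofReal_norm, ENNReal.ofReal_le_one, norm_inv, Complex.norm_real,
      Real.norm_of_nonneg (by positivity)]
    exact inv_le_one_of_one_le₀ (one_le_pow₀ (by linarith [Real.pi_gt_three]))
  rw [fourierT_moyalComm ℏ ha hA hb hB,
    ← integral_sub (hInt _ (by fun_prop)) (hInt _ (by fun_prop)), enorm_mul]
  refine (mul_le_mul_left hpi _).trans ?_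
  rw [one_mul]
  refine (enorm_integral_le_lintegral_enorm _).trans (lintegral_mono fun w => ?_)
  rw [← ofReal_norm, ← mul_sub, norm_mul, norm_mul]
  refine ENNReal.ofReal_le_ofReal ?_
  calc _ ≤ ‖fourierT a w‖ * ‖fourierT b (ζ - w)‖ * (2 * |ℏ / 2 * symp w (ζ - w)|) := by
        gcongr
        exact norm_cexp_sub_cexp_neg_le _
    _ = ‖fourierT a w‖ * ‖fourierT b (ζ - w)‖ * (ℏ * |symp w (ζ - w)|) := by
        rw [abs_mul, abs_of_nonneg (by positivity : 0 ≤ ℏ / 2)]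
        ring
    _ ≤ ‖fourierT a w‖ * ‖fourierT b (ζ - w)‖ * (ℏ * (normP w * normP (ζ - w))) := by
        gcongr
        exact abs_symp_le _ _
    _ = _ := by ring

theorem mul_exp_sub_mul_le {σ : ℝ} (hσ : 0 < σ) (s x : ℝ) :
    x * Real.exp ((s - σ) * x) ≤ (Real.exp 1 * σ)⁻¹ * Real.exp (s * x) := by
  have h1 : σ * x ≤ Real.exp (σ * x - 1) := by linarith [Real.add_one_le_exp (σ * x - 1)]
  have h2 : x ≤ (Real.exp 1 * σ)⁻¹ * Real.exp (σ * x) := by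
    rw [inv_mul_eq_div, le_div_iff₀ (by positivity)]
    rw [Real.exp_sub, le_div_iff₀ (Real.exp_pos 1)] at h1
    linarith
  calc x * Real.exp ((s - σ) * x)
      ≤ (Real.exp 1 * σ)⁻¹ * Real.exp (σ * x) * Real.exp ((s - σ) * x) := by gcongr
    _ = _ := by rw [mul_assoc, ← Real.exp_add]; ring_nf

theorem lintegral_weighted_le_Anorm {d : ℕ} {σ : ℝ} (hσ : 0 < σ) (s : ℝ) (a : Pd d → ℂ) :
    ∫⁻ w, ENNReal.ofReal (‖fourierT a w‖ * normP w * Real.exp ((s - σ) * normP w)) ≤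
      ENNReal.ofReal (Real.exp 1 * σ)⁻¹ * Anorm s a := by
  rw [Anorm, ← lintegral_const_mul' _ _ ENNReal.ofReal_ne_top]
  refine lintegral_mono fun w => ?_
  rw [← ENNReal.ofReal_mul (by positivity)]
  refine ENNReal.ofReal_le_ofReal ?_
  calc _ = ‖fourierT a w‖ * (normP w * Real.exp ((s - σ) * normP w)) := by ring
    _ ≤ ‖fourierT a w‖ * ((Real.exp 1 * σ)⁻¹ * Real.exp (s * normP w)) :=
        mul_le_mul_of_nonneg_left (mul_exp_sub_mul_le hσ s _) (norm_nonneg _)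
    _ = _ := by ring

theorem lintegral_lintegral_mul_sub {d : ℕ} {f g : Pd d → ℝ≥0∞} (hf : Measurable f)
    (hg : Measurable g) :
    ∫⁻ ζ, ∫⁻ w, f w * g (ζ - w) = (∫⁻ w, f w) * ∫⁻ v, g v := by
  have h : ∀ w, ∫⁻ ζ, f w * g (ζ - w) = f w * ∫⁻ v, g v := fun w => by
    rw [lintegral_const_mul _ (by fun_prop), lintegral_sub_right_eq_self]
  rw [lintegral_lintegral_swap (by fun_prop)]
  simp only [h]
  rw [lintegral_mul_const _ hf]

/-- Bound for the Moyal commutator when the weight is lowered by `σ` on the first factor and by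
`τ` on the second one. -/
theorem Anorm_moyalComm_le {d : ℕ} {ρ ℏ σ τ : ℝ} (hρ : 0 ≤ ρ) (hℏ : 0 ≤ ℏ) (hσ : 0 < σ)
    (hτ : 0 < τ) {a b : Pd d → ℂ} (ha : Integrable a) (hA : Integrable (fourierT a))
    (hb : Integrable b) (hB : Integrable (fourierT b)) :
    Anorm ρ (moyalComm ℏ a b) ≤ ENNReal.ofReal (ℏ / (Real.exp 1 ^ 2 * τ * σ)) *
      Anorm (ρ + σ) a * Anorm (ρ + τ) b := by
  let F : (Pd d → ℂ) → Pd d → ℝ≥0∞ := fun f w =>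
    ENNReal.ofReal (‖fourierT f w‖ * normP w * Real.exp (ρ * normP w))
  have hF : ∀ {f : Pd d → ℂ}, Integrable f → Measurable (F f) := fun hf =>
    (ENNReal.continuous_ofReal.comp (((continuous_fourierT hf).norm.mul continuous_normP).mul
      (by fun_prop))).measurable
  calc Anorm ρ (moyalComm ℏ a b)
      ≤ ∫⁻ ζ, ENNReal.ofReal ℏ * ∫⁻ w, F a w * F b (ζ - w) := by
        refine lintegral_mono fun ζ => ?_
        rw [ENNReal.ofReal_mul (norm_nonneg _), ofReal_norm]
        refine (mul_le_mul_left (enorm_fourierT_moyalComm_le hℏ ha hA hb hB ζ) _).trans ?_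
        rw [← lintegral_mul_const' _ _ ENNReal.ofReal_ne_top,
          ← lintegral_const_mul' _ _ ENNReal.ofReal_ne_top]
        refine lintegral_mono fun w => ?_
        have h0 := normP_nonneg w
        have h1 := normP_nonneg (ζ - w)
        simp only [F]
        rw [← ENNReal.ofReal_mul (by positivity), ← ENNReal.ofReal_mul (by positivity),
          ← ENNReal.ofReal_mul hℏ]
        refine ENNReal.ofReal_le_ofReal ?_
        have htri : normP ζ ≤ normP w + normP (ζ - w) := by
          simpa using normP_add_le w (ζ - w)
        calc _ ≤ ℏ * (‖fourierT a w‖ * normP w) * (‖fourierT b (ζ - w)‖ * normP (ζ - w)) *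
              Real.exp (ρ * (normP w + normP (ζ - w))) := by gcongr
          _ = _ := by rw [mul_add, Real.exp_add]; ring
    _ = ENNReal.ofReal ℏ * ((∫⁻ w, F a w) * ∫⁻ v, F b v) := by
        rw [lintegral_const_mul' _ _ ENNReal.ofReal_ne_top,
          lintegral_lintegral_mul_sub (hF ha) (hF hb)]
    _ ≤ ENNReal.ofReal ℏ * ((ENNReal.ofReal (Real.exp 1 * σ)⁻¹ * Anorm (ρ + σ) a) *
          (ENNReal.ofReal (Real.exp 1 * τ)⁻¹ * Anorm (ρ + τ) b)) := by
        gcongr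
        · simpa [F] using lintegral_weighted_le_Anorm hσ (ρ + σ) a
        · simpa [F] using lintegral_weighted_le_Anorm hτ (ρ + τ) b
    _ = _ := by
        rw [show ℏ / (Real.exp 1 ^ 2 * τ * σ) =
            ℏ * ((Real.exp 1 * σ)⁻¹ * (Real.exp 1 * τ)⁻¹) by field_simp,
          ENNReal.ofReal_mul hℏ, ENNReal.ofReal_mul (by positivity)]
        ring

theorem Anorm_mono {d : ℕ} {s t : ℝ} (h : s ≤ t) (a : Pd d → ℂ) : Anorm s a ≤ Anorm t a := by
  refine lintegral_mono fun w => ENNReal.ofReal_le_ofReal ?_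
  have := normP_nonneg w
  gcongr

theorem MemAs.integrable_fourierT {d : ℕ} {s : ℝ} (hs : 0 ≤ s) {a : Pd d → ℂ}
    (ha : MemAs s a) : Integrable (fourierT a) := by
  refine ⟨(continuous_fourierT ha.1).aestronglyMeasurable, ?_⟩
  refine lt_of_le_of_lt (lintegral_mono fun w => ?_) ((Anorm_mono hs a).trans_lt ha.2)
  simp

/-- For a, b ∈ A_s, the Moyal commutator [a,b]_ℏ belongs to
A_{s−σ₁−σ₂} and ‖[a,b]_ℏ‖_{s−σ₁−σ₂} ≤ (2ℏ/(e²σ₁(σ₁+σ₂))) ‖a‖_s ‖b‖_{s−σ₂}. -/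
theorem moyalComm_bound {d : ℕ} (s ℏ σ₁ σ₂ : ℝ) (hs : 0 < s) (hℏ : 0 < ℏ)
    (hσ₁ : 0 < σ₁) (hσ₂ : 0 < σ₂) (hσs : σ₁ + σ₂ < s)
    (a b : Pd d → ℂ) (ha : MemAs s a) (hb : MemAs s b) :
    MemAs (s - σ₁ - σ₂) (moyalComm ℏ a b) ∧
      Anorm (s - σ₁ - σ₂) (moyalComm ℏ a b) ≤
        ENNReal.ofReal (2 * ℏ / (Real.exp 1 ^ 2 * σ₁ * (σ₁ + σ₂))) *
          Anorm s a * Anorm (s - σ₂) b := by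
  have hA := ha.integrable_fourierT hs.le
  have hB := hb.integrable_fourierT hs.le
  have hbound : Anorm (s - σ₁ - σ₂) (moyalComm ℏ a b) ≤
      ENNReal.ofReal (2 * ℏ / (Real.exp 1 ^ 2 * σ₁ * (σ₁ + σ₂))) *
        Anorm s a * Anorm (s - σ₂) b := by
    have h := Anorm_moyalComm_le (ρ := s - σ₁ - σ₂) (by linarith) hℏ.le
      (add_pos hσ₁ hσ₂) hσ₁ ha.1 hA hb.1 hB
    rw [show s - σ₁ - σ₂ + (σ₁ + σ₂) = s by ring, show s - σ₁ - σ₂ + σ₁ = s - σ₂ by ring] at h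
    refine h.trans ?_
    gcongr
    linarith
  refine ⟨⟨(integrable_moyal ℏ hA hb.1 hB).sub (integrable_moyal ℏ hB ha.1 hA), ?_⟩, hbound⟩
  exact hbound.trans_lt (ENNReal.mul_lt_top (ENNReal.mul_lt_top ENNReal.ofReal_lt_top ha.2)
    ((Anorm_mono (by linarith) b).trans_lt hb.2))

end
end
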